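/- Suppose α₁, β₁, α₂, β₂ ≥ 0 and α₁β₂ ≠ 0. Then: (1) if α₂ ≠ 0 or β₁ ≠ 0, the system has a unique equilibrium with non-negative coordinates; this equilibrium has strictly positive coordinates, is stable, and attracts every complete solution with initial condition x₀ ≥ 0, y₀ > 0 (every such initial condition yields a complete solution when α₂ > 0, and every initial condition with x₀ > 0, y₀ > 0 does so when α₂ = 0); (2) if α₂ = β₁ = 0, every complete solution with x₀ > 0, y₀ > 0 is periodic of period 3, and the system has a unique equilibrium. -/

import Mathlib

open Filter Topology

/-- `(x, y)` is a complete solution of the planar rational system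
`x_{n+1} = (α₁ + β₁ xₙ)/yₙ`, `y_{n+1} = (α₂ + β₂ xₙ)/yₙ`. -/
def IsSol (a1 b1 a2 b2 : ℝ) (x y : ℕ → ℝ) : Prop :=
  (∀ n, y n ≠ 0) ∧
  (∀ n, x (n + 1) = (a1 + b1 * x n) / y n) ∧
  (∀ n, y (n + 1) = (a2 + b2 * x n) / y n)

/-- `p` is an equilibrium of the system. -/
def IsEquilib (a1 b1 a2 b2 : ℝ) (p : ℝ × ℝ) : Prop :=
  p.2 ≠ 0 ∧ p.1 = (a1 + b1 * p.1) / p.2 ∧ p.2 = (a2 + b2 * p.1) / p.2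

/-- The equilibrium `p` is stable. -/
def Stable (a1 b1 a2 b2 : ℝ) (p : ℝ × ℝ) : Prop :=
  ∀ ε > 0, ∃ δ > 0, ∀ x y : ℕ → ℝ, IsSol a1 b1 a2 b2 x y →
    dist (x 0, y 0) p < δ → ∀ n, dist (x n, y n) p < ε

/-- The equilibrium `p` is asymptotically stable. -/
def AsympStable (a1 b1 a2 b2 : ℝ) (p : ℝ × ℝ) : Prop :=
  Stable a1 b1 a2 b2 p ∧ ∃ δ > 0, ∀ x y : ℕ → ℝ, IsSol a1 b1 a2 b2 x y →
    dist (x 0, y 0) p < δ → Tendsto (fun n => (x n, y n)) atTop (𝓝 p)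

section Averaging

variable {s s' t t' : ℝ} {p q r : ℕ → ℝ}

/-- The recursion replacing `(p, q, r)` by `r` and two weighted sums of `p` and `q`. -/
structure IsAveraging (s s' t t' : ℝ) (p q r : ℕ → ℝ) : Prop where
  fst : ∀ n, p (n + 1) = r n
  snd : ∀ n, q (n + 1) = s * p n + s' * q n
  trd : ∀ n, r (n + 1) = t * p n + t' * q n

theorem IsAveraging.ge_of_ge (h : IsAveraging s s' t t' p q r) (hs : 0 ≤ s) (hs' : 0 ≤ s')
    (ht : 0 ≤ t) (ht' : 0 ≤ t') (hss : s + s' = 1) (htt : t + t' = 1) {m : ℝ} {k : ℕ}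
    (hk : m ≤ p k ∧ m ≤ q k ∧ m ≤ r k) {n : ℕ} (hkn : k ≤ n) : m ≤ p n ∧ m ≤ q n ∧ m ≤ r n := by
  induction n, hkn using Nat.le_induction with
  | base => exact hk
  | succ n _ ih =>
    obtain ⟨h1, h2, h3⟩ := ih
    rw [h.fst, h.snd, h.trd]
    refine ⟨h3, ?_, ?_⟩
    · linear_combination s * h1 + s' * h2 - m * hss
    · linear_combination t * h1 + t' * h2 - m * htt

theorem IsAveraging.neg (h : IsAveraging s s' t t' p q r) :
    IsAveraging s s' t t' (fun n => -p n) (fun n => -q n) (fun n => -r n) :=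
  ⟨fun n => by rw [h.fst], fun n => by rw [h.snd]; ring, fun n => by rw [h.trd]; ring⟩

theorem IsAveraging.sub_const (h : IsAveraging s s' t t' p q r) (hss : s + s' = 1)
    (htt : t + t' = 1) (m : ℝ) :
    IsAveraging s s' t t' (fun n => p n - m) (fun n => q n - m) (fun n => r n - m) :=
  ⟨fun n => by rw [h.fst], fun n => by rw [h.snd]; linear_combination m * hss,
    fun n => by rw [h.trd]; linear_combination m * htt⟩

theorem IsAveraging.le_of_le (h : IsAveraging s s' t t' p q r) (hs : 0 ≤ s) (hs' : 0 ≤ s')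
    (ht : 0 ≤ t) (ht' : 0 ≤ t') (hss : s + s' = 1) (htt : t + t' = 1) {m : ℝ} {k : ℕ}
    (hk : p k ≤ m ∧ q k ≤ m ∧ r k ≤ m) {n : ℕ} (hkn : k ≤ n) : p n ≤ m ∧ q n ≤ m ∧ r n ≤ m := by
  simpa using h.neg.ge_of_ge hs hs' ht ht' hss htt (m := -m) (k := k) (by simpa using hk) hkn

/-- Under primitivity, five steps of the recursion mix all three coordinates. -/
theorem exists_mixing_const (hs : 0 < s) (hs' : 0 ≤ s') (ht : 0 ≤ t) (ht' : 0 < t')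
    (hprim : 0 < s' ∨ 0 < t) : ∃ c > 0, ∀ p q r : ℕ → ℝ, IsAveraging s s' t t' p q r →
      ∀ n, 0 ≤ p n → 0 ≤ q n → 0 ≤ r n →
        c * (p n + q n + r n) ≤ p (n + 5) ∧ c * (p n + q n + r n) ≤ q (n + 5) ∧
          c * (p n + q n + r n) ≤ r (n + 5) := by
  obtain ⟨a, b, c, d, e, f, g, k, l, ha, hb, hc, hd, he, hf, hg, hk, hl, H⟩ :
      ∃ a b c d e f g k l : ℝ, 0 < a ∧ 0 < b ∧ 0 < c ∧ 0 < d ∧ 0 < e ∧ 0 < f ∧ 0 < g ∧ 0 < k ∧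
        0 < l ∧ ∀ p q r : ℕ → ℝ, IsAveraging s s' t t' p q r → ∀ n,
          p (n + 5) = a * p n + b * q n + c * r n ∧ q (n + 5) = d * p n + e * q n + f * r n ∧
          r (n + 5) = g * p n + k * q n + l * r n := by
    refine ⟨s * s' * s' * t' + 2 * s * t * t',
      s * t' * t' + s' * s' * s' * t' + s' * t * t',
      s * s' * t' + t * t,
      2 * s * s * s' * t' + s * s' * s' * s' * s' + s * s' * s' * t + s * t * t,
      3 * s * s' * s' * t' + s * t * t' + s' * s' * s' * s' * s',
      s * s * t' + s * s' * s' * s' + s * s' * t,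
      s * s * t' * t' + s * s' * s' * s' * t' + 2 * s * s' * t * t' + t * t * t,
      2 * s * s' * t' * t' + s' * s' * s' * s' * t' + s' * s' * t * t' + t * t * t',
      s * s' * s' * t' + 2 * s * t * t',
      ?_, ?_, ?_, ?_, ?_, ?_, ?_, ?_, ?_, fun p q r h n => ⟨?_, ?_, ?_⟩⟩
    iterate 9
      · rcases hprim with h | h <;> positivity
    all_goals
      simp only [h.fst, h.snd, h.trd]
      ring
  set μ := min (min (min a b) (min c d)) (min (min e f) (min (min g k) l)) with hμ
  have hμ0 : 0 < μ := by simp [*]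
  have hle : (μ ≤ a ∧ μ ≤ b ∧ μ ≤ c) ∧ (μ ≤ d ∧ μ ≤ e ∧ μ ≤ f) ∧ μ ≤ g ∧ μ ≤ k ∧ μ ≤ l := by
    simp [hμ]
  obtain ⟨⟨h1, h2, h3⟩, ⟨h4, h5, h6⟩, h7, h8, h9⟩ := hle
  refine ⟨μ, hμ0, fun p q r h n hp hq hr => ?_⟩
  obtain ⟨e1, e2, e3⟩ := H p q r h n
  rw [e1, e2, e3, mul_add, mul_add]
  refine ⟨?_, ?_, ?_⟩ <;> gcongr

theorem IsAveraging.exists_tendsto (h : IsAveraging s s' t t' p q r) (hs : 0 < s)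
    (hs' : 0 ≤ s') (ht : 0 ≤ t) (ht' : 0 < t') (hss : s + s' = 1) (htt : t + t' = 1)
    (hprim : 0 < s' ∨ 0 < t) :
    ∃ L, Tendsto p atTop (𝓝 L) ∧ Tendsto q atTop (𝓝 L) ∧ Tendsto r atTop (𝓝 L) := by
  set m : ℕ → ℝ := fun n => min (p n) (min (q n) (r n)) with hm
  set M : ℕ → ℝ := fun n => max (p n) (max (q n) (r n)) with hM
  have hmle : ∀ n, m n ≤ p n ∧ m n ≤ q n ∧ m n ≤ r n := fun n => by simp [hm]
  have hMge : ∀ n, p n ≤ M n ∧ q n ≤ M n ∧ r n ≤ M n := fun n => by simp [hM]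
  have hmono : Monotone m := fun k n hkn => by
    obtain ⟨h1, h2, h3⟩ := h.ge_of_ge hs.le hs' ht ht'.le hss htt (hmle k) hkn
    exact le_min h1 (le_min h2 h3)
  have hanti : Antitone M := fun k n hkn => by
    obtain ⟨h1, h2, h3⟩ := h.le_of_le hs.le hs' ht ht'.le hss htt (hMge k) hkn
    exact max_le h1 (max_le h2 h3)
  have hmM : ∀ n, m n ≤ M n := fun n => (hmle n).1.trans (hMge n).1
  have htm := tendsto_atTop_ciSup hmono
    ⟨M 0, by rintro _ ⟨n, rfl⟩; exact (hmM n).trans (hanti n.zero_le)⟩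
  have htM := tendsto_atTop_ciInf hanti
    ⟨m 0, by rintro _ ⟨n, rfl⟩; exact (hmono n.zero_le).trans (hmM n)⟩
  set l := ⨆ n, m n
  set u := ⨅ n, M n
  obtain ⟨c, hc, H⟩ := exists_mixing_const hs hs' ht ht' hprim
  have hstep : ∀ n, m n + c * (M n - m n) ≤ m (n + 5) := fun n => by
    obtain ⟨h1, h2, h3⟩ := hmle n
    obtain ⟨k1, k2, k3⟩ := H _ _ _ (h.sub_const hss htt (m n)) n (sub_nonneg.2 h1)
      (sub_nonneg.2 h2) (sub_nonneg.2 h3)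
    have hsum : M n - m n ≤ (p n - m n) + (q n - m n) + (r n - m n) := by
      rw [sub_le_iff_le_add]
      refine max_le ?_ (max_le ?_ ?_) <;> linarith
    have := mul_le_mul_of_nonneg_left hsum hc.le
    refine le_min ?_ (le_min ?_ ?_) <;> linarith
  have hlim : l + c * (u - l) ≤ l :=
    le_of_tendsto_of_tendsto' (htm.add ((htM.sub htm).const_mul c))
      (htm.comp (tendsto_add_atTop_nat 5)) hstep
  have hlu : l ≤ u := le_of_tendsto_of_tendsto' htm htM hmM
  have hul : u = l := le_antisymm (by nlinarith) hlu
  rw [hul] at htM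
  exact ⟨l, tendsto_of_tendsto_of_tendsto_of_le_of_le htm htM (fun n => (hmle n).1)
      (fun n => (hMge n).1),
    tendsto_of_tendsto_of_tendsto_of_le_of_le htm htM (fun n => (hmle n).2.1)
      (fun n => (hMge n).2.1),
    tendsto_of_tendsto_of_tendsto_of_le_of_le htm htM (fun n => (hmle n).2.2)
      (fun n => (hMge n).2.2)⟩

end Averaging

section System

variable {a1 b1 a2 b2 : ℝ} {x y : ℕ → ℝ} {X Y : ℝ}

theorem exists_isSol (ha1 : 0 < a1) (hb1 : 0 ≤ b1) (ha2 : 0 ≤ a2) (hb2 : 0 < b2) {x0 y0 : ℝ}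
    (hx0 : 0 ≤ x0) (hy0 : 0 < y0) (hpos : 0 < a2 + b2 * x0) :
    ∃ x y : ℕ → ℝ, IsSol a1 b1 a2 b2 x y ∧ x 0 = x0 ∧ y 0 = y0 := by
  let F : ℝ × ℝ → ℝ × ℝ := fun z => ((a1 + b1 * z.1) / z.2, (a2 + b2 * z.1) / z.2)
  have hF : ∀ n, 0 ≤ (F^[n] (x0, y0)).1 ∧ 0 < (F^[n] (x0, y0)).2 ∧
      0 < a2 + b2 * (F^[n] (x0, y0)).1 := by
    intro n
    induction n with
    | zero => exact ⟨hx0, hy0, hpos⟩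
    | succ n ih =>
      obtain ⟨h1, h2, h3⟩ := ih
      rw [Function.iterate_succ_apply']
      have hx : 0 < (F (F^[n] (x0, y0))).1 := by
        simp only [F]
        positivity
      exact ⟨hx.le, div_pos h3 h2, by positivity⟩
  refine ⟨fun n => (F^[n] (x0, y0)).1, fun n => (F^[n] (x0, y0)).2,
    ⟨fun n => (hF n).2.1.ne', fun n => ?_, fun n => ?_⟩, rfl, rfl⟩ <;>
  simp only [Function.iterate_succ_apply', F]

theorem IsSol.nonneg_pos (h : IsSol a1 b1 a2 b2 x y) (ha1 : 0 ≤ a1) (hb1 : 0 ≤ b1)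
    (ha2 : 0 ≤ a2) (hb2 : 0 ≤ b2) (hx : 0 ≤ x 0) (hy : 0 < y 0) (n : ℕ) : 0 ≤ x n ∧ 0 < y n := by
  induction n with
  | zero => exact ⟨hx, hy⟩
  | succ n ih =>
    obtain ⟨h1, h2⟩ := ih
    refine ⟨?_, lt_of_le_of_ne ?_ (h.1 (n + 1)).symm⟩
    · rw [h.2.1]; positivity
    · rw [h.2.2]; positivity

/-- In projective coordinates normalised by a positive equilibrium the system is linear
and averaging. -/
theorem IsSol.exists_isAveraging (h : IsSol a1 b1 a2 b2 x y) (hX : 0 < X) (hY : 0 < Y)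
    (hy : ∀ n, 0 < y n) : ∃ p q r : ℕ → ℝ,
      IsAveraging (a1 / (Y * X)) (b1 / Y) (a2 / Y ^ 2) (b2 * X / Y ^ 2) p q r ∧
      p 0 = 1 ∧ ∀ n, 0 < p n ∧ q n = p n * (x n / X) ∧ r n = p n * (y n / Y) := by
  refine ⟨fun n => ∏ k ∈ Finset.range n, (y k / Y),
    fun n => (∏ k ∈ Finset.range n, (y k / Y)) * (x n / X),
    fun n => (∏ k ∈ Finset.range n, (y k / Y)) * (y n / Y),
    ⟨fun n => Finset.prod_range_succ _ n, fun n => ?_, fun n => ?_⟩, by simp,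
    fun n => ⟨Finset.prod_pos fun k _ => div_pos (hy k) hY, rfl, rfl⟩⟩
  · have := h.1 n
    simp only [Finset.prod_range_succ, h.2.1]
    field_simp
  · have := h.1 n
    simp only [Finset.prod_range_succ, h.2.2]
    field_simp

theorem weights_add_eq_one (hX : 0 < X) (hY : 0 < Y) (h1 : Y * X = a1 + b1 * X)
    (h2 : Y ^ 2 = a2 + b2 * X) :
    a1 / (Y * X) + b1 / Y = 1 ∧ a2 / Y ^ 2 + b2 * X / Y ^ 2 = 1 := by
  constructor
  · field_simp
    linarith
  · field_simp
    linarith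

theorem tendsto_of_pos_equilib (ha1 : 0 < a1) (hb1 : 0 ≤ b1) (ha2 : 0 ≤ a2) (hb2 : 0 < b2)
    (hprim : 0 < b1 ∨ 0 < a2) (hX : 0 < X) (hY : 0 < Y) (h1 : Y * X = a1 + b1 * X)
    (h2 : Y ^ 2 = a2 + b2 * X) (h : IsSol a1 b1 a2 b2 x y) (hx : 0 ≤ x 0) (hy : 0 < y 0) :
    Tendsto (fun n => (x n, y n)) atTop (𝓝 (X, Y)) := by
  have hpos := h.nonneg_pos ha1.le hb1 ha2 hb2.le hx hy
  obtain ⟨p, q, r, hA, -, hpqr⟩ := h.exists_isAveraging hX hY fun n => (hpos n).2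
  obtain ⟨hss, htt⟩ := weights_add_eq_one hX hY h1 h2
  have hs : 0 < a1 / (Y * X) := by positivity
  have hs' : 0 ≤ b1 / Y := by positivity
  have ht : 0 ≤ a2 / Y ^ 2 := by positivity
  have ht' : 0 < b2 * X / Y ^ 2 := by positivity
  obtain ⟨L, hp, hq, hr⟩ := hA.exists_tendsto hs hs' ht ht' hss htt
    (hprim.imp (fun _ => by positivity) (fun _ => by positivity))
  have hx1 : 0 < x 1 := by
    rw [h.2.1]
    positivity
  have hp1 := (hpqr 1).1
  have hq1 : 0 < q 1 := by
    rw [(hpqr 1).2.1]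
    positivity
  have hr1 : 0 < r 1 := by
    have := (hpos 1).2
    rw [(hpqr 1).2.2]
    positivity
  have hL : 0 < L := by
    refine lt_of_lt_of_le (lt_min hp1 (lt_min hq1 hr1)) (ge_of_tendsto hp ?_)
    filter_upwards [eventually_ge_atTop 1] with n hn
    exact (hA.ge_of_ge hs.le hs' ht ht'.le hss htt (by simp) hn).1
  have hdiv : ∀ w : ℕ → ℝ, ∀ z : ℕ → ℝ, ∀ Z : ℝ, 0 < Z → Tendsto w atTop (𝓝 L) →
      (∀ n, w n = p n * (z n / Z)) → Tendsto z atTop (𝓝 Z) := by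
    intro w z Z hZ hw hwz
    have := (hw.div hp hL.ne').const_mul Z
    rw [div_self hL.ne', mul_one] at this
    refine this.congr fun n => ?_
    have := (hpqr n).1
    simp only [Pi.div_apply, hwz]
    field_simp
  exact (hdiv q x X hX hq fun n => (hpqr n).2.1).prodMk_nhds
    (hdiv r y Y hY hr fun n => (hpqr n).2.2)

theorem stable_of_pos_equilib (ha1 : 0 ≤ a1) (hb1 : 0 ≤ b1) (ha2 : 0 ≤ a2) (hb2 : 0 ≤ b2)
    (hX : 0 < X) (hY : 0 < Y) (h1 : Y * X = a1 + b1 * X) (h2 : Y ^ 2 = a2 + b2 * X) :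
    Stable a1 b1 a2 b2 (X, Y) := by
  intro ε hε
  obtain ⟨η, hη, hη2, hηX, hηY⟩ : ∃ η > 0, η ≤ 1 / 2 ∧ 4 * η * X < ε ∧ 4 * η * Y < ε := by
    have hd : 0 < 8 * (X + Y) := by positivity
    refine ⟨min (1 / 2) (ε / (8 * (X + Y))), by positivity, min_le_left _ _, ?_, ?_⟩
    all_goals
      have := (le_div_iff₀ hd).1 (min_le_right (1 / 2) (ε / (8 * (X + Y))))
      have h0 : 0 < min (1 / 2) (ε / (8 * (X + Y))) := by positivity
      nlinarith [mul_pos h0 hX, mul_pos h0 hY]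
  refine ⟨η * min X Y, by positivity, fun x y h hd => ?_⟩
  rw [Prod.dist_eq, max_lt_iff, Real.dist_eq, Real.dist_eq, abs_lt, abs_lt] at hd
  obtain ⟨⟨hx1, hx2⟩, hy1, hy2⟩ := hd
  have hmX := mul_le_mul_of_nonneg_left (min_le_left X Y) hη.le
  have hmY := mul_le_mul_of_nonneg_left (min_le_right X Y) hη.le
  simp only at hx1 hx2 hy1 hy2
  have hpos := h.nonneg_pos ha1 hb1 ha2 hb2 (by nlinarith) (by nlinarith)
  obtain ⟨p, q, r, hA, hp0, hpqr⟩ := h.exists_isAveraging hX hY fun n => (hpos n).2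
  obtain ⟨hss, htt⟩ := weights_add_eq_one hX hY h1 h2
  have hs : 0 ≤ a1 / (Y * X) := by positivity
  have hs' : 0 ≤ b1 / Y := by positivity
  have ht : 0 ≤ a2 / Y ^ 2 := by positivity
  have ht' : 0 ≤ b2 * X / Y ^ 2 := by positivity
  have hlow : 1 - η ≤ p 0 ∧ 1 - η ≤ q 0 ∧ 1 - η ≤ r 0 := by
    rw [(hpqr 0).2.1, (hpqr 0).2.2, hp0, one_mul, one_mul, le_div_iff₀ hX, le_div_iff₀ hY]
    refine ⟨?_, ?_, ?_⟩ <;> linarith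
  have hupp : p 0 ≤ 1 + η ∧ q 0 ≤ 1 + η ∧ r 0 ≤ 1 + η := by
    rw [(hpqr 0).2.1, (hpqr 0).2.2, hp0, one_mul, one_mul, div_le_iff₀ hX, div_le_iff₀ hY]
    refine ⟨?_, ?_, ?_⟩ <;> linarith
  intro n
  obtain ⟨l1, l2, l3⟩ := hA.ge_of_ge hs hs' ht ht' hss htt hlow n.zero_le
  obtain ⟨u1, u2, u3⟩ := hA.le_of_le hs hs' ht ht' hss htt hupp n.zero_le
  have hclose : ∀ w z Z : ℝ, 0 < Z → 4 * η * Z < ε → w = p n * (z / Z) → 1 - η ≤ w →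
      w ≤ 1 + η → |z - Z| < ε := by
    intro w z Z hZ hηZ hw hl hu
    refine lt_of_le_of_lt ?_ hηZ
    have hp := (hpqr n).1
    have hz : p n * (z - Z) = (w - p n) * Z := by
      rw [hw]
      field_simp
    have habs : p n * |z - Z| ≤ 2 * η * Z := by
      have hmul := abs_mul (p n) (z - Z)
      rw [abs_of_pos hp, hz, abs_mul, abs_of_pos hZ] at hmul
      rw [← hmul]
      gcongr
      rw [abs_le]
      constructor <;> linarith
    nlinarith [abs_nonneg (z - Z)]
  rw [Prod.dist_eq, max_lt_iff, Real.dist_eq, Real.dist_eq]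
  exact ⟨hclose _ _ _ hX hηX (hpqr n).2.1 l2 u2, hclose _ _ _ hY hηY (hpqr n).2.2 l3 u3⟩

/-- The second coordinate of a non-negative equilibrium is a root of the characteristic
polynomial exceeding `b1` and `√a2`. -/
theorem IsEquilib.charpoly (ha1 : 0 < a1) (hb1 : 0 ≤ b1) (hb2 : 0 < b2) {z : ℝ × ℝ}
    (h : IsEquilib a1 b1 a2 b2 z) (hx : 0 ≤ z.1) (hy : 0 ≤ z.2) :
    0 < z.1 ∧ 0 < z.2 ∧ b1 < z.2 ∧ a2 < z.2 ^ 2 ∧ z.1 = (z.2 ^ 2 - a2) / b2 ∧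
      (z.2 ^ 2 - a2) * (z.2 - b1) = a1 * b2 := by
  obtain ⟨h0, h1, h2⟩ := h
  have hy' : 0 < z.2 := lt_of_le_of_ne hy h0.symm
  have hx' : 0 < z.1 := by
    rw [h1]
    positivity
  rw [eq_div_iff h0] at h1 h2
  have hb : 0 < b2 * z.1 := by positivity
  have hz : z.1 = (z.2 ^ 2 - a2) / b2 := by
    rw [eq_div_iff hb2.ne']
    linarith
  refine ⟨hx', hy', by nlinarith, by nlinarith, hz, ?_⟩
  linear_combination (z.2 - b1) * h2 + b2 * h1

theorem exists_root (hb1 : 0 ≤ b1) (ha2 : 0 ≤ a2) {d : ℝ} (hd : 0 < d) :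
    ∃ Y, 0 < Y ∧ b1 < Y ∧ a2 < Y ^ 2 ∧ (Y ^ 2 - a2) * (Y - b1) = d := by
  set l := max b1 (√a2) with hl
  set u := l + a2 + d + 1 with hu
  have hl0 : 0 ≤ l := hb1.trans (le_max_left _ _)
  have hlb : b1 ≤ l := le_max_left _ _
  have hla : a2 ≤ l ^ 2 := (Real.sqrt_le_left hl0).1 (le_max_right _ _)
  have hfl : (l ^ 2 - a2) * (l - b1) = 0 := by
    rcases max_choice b1 (√a2) with h | h
    · rw [← hl] at h
      rw [h, sub_self, mul_zero]
    · rw [← hl] at h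
      rw [h, Real.sq_sqrt ha2, sub_self, zero_mul]
  have hfu : d ≤ (u ^ 2 - a2) * (u - b1) := by
    have h1 : d ≤ u ^ 2 - a2 := by nlinarith
    have h2 : 1 ≤ u - b1 := by linarith
    nlinarith
  obtain ⟨Y, ⟨hY1, -⟩, hY⟩ := intermediate_value_Icc (by linarith : l ≤ u)
    (f := fun Y => (Y ^ 2 - a2) * (Y - b1)) (by fun_prop) ⟨by rw [hfl]; exact hd.le, hfu⟩
  simp only at hY
  have hYa : 0 ≤ Y ^ 2 - a2 := by nlinarith
  have hb : b1 < Y := lt_of_le_of_ne (hlb.trans hY1) fun he => by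
    rw [he, sub_self, mul_zero] at hY
    exact hd.ne hY
  refine ⟨Y, hb1.trans_lt hb, hb, ?_, hY⟩
  by_contra hcon
  have : Y ^ 2 - a2 = 0 := by linarith
  rw [this, zero_mul] at hY
  exact hd.ne hY

theorem root_unique {Y Z d : ℝ} (hb1 : 0 ≤ b1) (hY : b1 < Y) (hZ : b1 < Z) (hY' : a2 < Y ^ 2)
    (hZ' : a2 < Z ^ 2) (h1 : (Y ^ 2 - a2) * (Y - b1) = d) (h2 : (Z ^ 2 - a2) * (Z - b1) = d) :
    Y = Z := by
  have key : ∀ {U V : ℝ}, b1 < U → a2 < U ^ 2 → U < V →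
      (U ^ 2 - a2) * (U - b1) < (V ^ 2 - a2) * (V - b1) := by
    intro U V hU hU' hUV
    have : U ^ 2 < V ^ 2 := by nlinarith
    exact mul_lt_mul'' (by linarith) (by linarith) (by linarith) (by linarith)
  rcases lt_trichotomy Y Z with h | h | h
  · exact absurd (h1.trans h2.symm) (key hY hY' h).ne
  · exact h
  · exact absurd (h2.trans h1.symm) (key hZ hZ' h).ne

theorem IsSol.periodic_three (h : IsSol a1 0 0 b2 x y) (ha1 : a1 ≠ 0) (hb2 : b2 ≠ 0) (n : ℕ) :
    x (n + 3) = x n ∧ y (n + 3) = y n := by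
  have hy0 := h.1 n
  have hx : x n ≠ 0 := fun hx => h.1 (n + 1) (by rw [h.2.2, hx]; simp)
  have ex1 : x (n + 1) = a1 / y n := by rw [h.2.1]; simp
  have ey1 : y (n + 1) = b2 * x n / y n := by rw [h.2.2]; simp
  have ex2 : x (n + 2) = a1 * y n / (b2 * x n) := by
    rw [h.2.1 (n + 1), ey1]
    field_simp
    ring
  have ey2 : y (n + 2) = a1 / x n := by
    rw [h.2.2 (n + 1), ey1, ex1]
    field_simp
    ring
  rw [h.2.1 (n + 2), h.2.2 (n + 2), ex2, ey2]
  constructor <;> field_simp <;> ring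

theorem existsUnique_isEquilib (ha1 : 0 < a1) (hb2 : 0 < b2) :
    ∃! z : ℝ × ℝ, IsEquilib a1 0 0 b2 z := by
  obtain ⟨Y, hY, -, -, hYd⟩ := exists_root le_rfl le_rfl (mul_pos ha1 hb2)
  have hY3 : Y ^ 3 = a1 * b2 := by linear_combination hYd
  refine ⟨(Y ^ 2 / b2, Y), ⟨hY.ne', ?_, ?_⟩, ?_⟩
  · simp only
    field_simp
    linear_combination hY3
  · simp only
    field_simp
    ring
  · rintro ⟨u, v⟩ ⟨h0, h1, h2⟩
    simp only at h0 h1 h2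
    rw [eq_div_iff h0] at h1 h2
    have hv : v ^ 3 = Y ^ 3 := by linear_combination v * h2 + b2 * h1 - hY3
    have hvY : v = Y := (Odd.strictMono_pow (by decide : Odd 3)).injective hv
    subst hvY
    rw [Prod.mk.injEq, eq_div_iff hb2.ne']
    exact ⟨by linarith, rfl⟩

end System

/-- non-negative coefficients with `α₁β₂ ≠ 0`: if `α₂ ≠ 0` or `β₁ ≠ 0`,
there is a unique non-negative equilibrium; it is positive, stable, and attracts every
complete solution with `x₀ ≥ 0`, `y₀ > 0` (such initial conditions always yield complete
solutions, for `x₀ > 0` when `α₂ = 0`); if `α₂ = β₁ = 0`, every complete solution with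
positive initial condition is 3-periodic and there is a unique equilibrium. -/
theorem stmt19 (a1 b1 a2 b2 : ℝ) (ha1 : 0 ≤ a1) (hb1 : 0 ≤ b1) (ha2 : 0 ≤ a2)
    (hb2 : 0 ≤ b2) (hne : a1 * b2 ≠ 0) :
    ((a2 ≠ 0 ∨ b1 ≠ 0) → ∃ p : ℝ × ℝ,
      (IsEquilib a1 b1 a2 b2 p ∧ 0 ≤ p.1 ∧ 0 ≤ p.2) ∧
      (∀ q : ℝ × ℝ, IsEquilib a1 b1 a2 b2 q → 0 ≤ q.1 → 0 ≤ q.2 → q = p) ∧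
      0 < p.1 ∧ 0 < p.2 ∧ Stable a1 b1 a2 b2 p ∧
      (∀ x y : ℕ → ℝ, IsSol a1 b1 a2 b2 x y → 0 ≤ x 0 → 0 < y 0 →
        Tendsto (fun n => (x n, y n)) atTop (𝓝 p)) ∧
      (0 < a2 → ∀ x0 y0 : ℝ, 0 ≤ x0 → 0 < y0 →
        ∃ x y : ℕ → ℝ, IsSol a1 b1 a2 b2 x y ∧ x 0 = x0 ∧ y 0 = y0) ∧
      (a2 = 0 → ∀ x0 y0 : ℝ, 0 < x0 → 0 < y0 →
        ∃ x y : ℕ → ℝ, IsSol a1 b1 a2 b2 x y ∧ x 0 = x0 ∧ y 0 = y0)) ∧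
    (a2 = 0 → b1 = 0 →
      (∀ x y : ℕ → ℝ, IsSol a1 b1 a2 b2 x y → 0 < x 0 → 0 < y 0 →
        ∀ n, x (n + 3) = x n ∧ y (n + 3) = y n) ∧
      (∃! p : ℝ × ℝ, IsEquilib a1 b1 a2 b2 p)) := by
  have ha1' : 0 < a1 := lt_of_le_of_ne ha1 fun h => hne (by rw [← h, zero_mul])
  have hb2' : 0 < b2 := lt_of_le_of_ne hb2 fun h => hne (by rw [← h, mul_zero])
  refine ⟨fun hor => ?_, ?_⟩
  · obtain ⟨Y, hY, hYb, hYa, hYd⟩ := exists_root hb1 ha2 (mul_pos ha1' hb2')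
    have hX : 0 < (Y ^ 2 - a2) / b2 := div_pos (by linarith) hb2'
    have h1 : Y * ((Y ^ 2 - a2) / b2) = a1 + b1 * ((Y ^ 2 - a2) / b2) := by
      field_simp
      linarith
    have h2 : Y ^ 2 = a2 + b2 * ((Y ^ 2 - a2) / b2) := by
      field_simp
      ring
    have hprim : 0 < b1 ∨ 0 < a2 :=
      hor.symm.imp (fun h => lt_of_le_of_ne hb1 h.symm) (fun h => lt_of_le_of_ne ha2 h.symm)
    refine ⟨((Y ^ 2 - a2) / b2, Y), ⟨⟨hY.ne', ?_, ?_⟩, hX.le, hY.le⟩, ?_, hX, hY,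
      stable_of_pos_equilib ha1 hb1 ha2 hb2 hX hY h1 h2,
      fun x y h hx hy => tendsto_of_pos_equilib ha1' hb1 ha2 hb2' hprim hX hY h1 h2 h hx hy,
      fun h x0 y0 hx hy => exists_isSol ha1' hb1 ha2 hb2' hx hy (by positivity),
      fun _ x0 y0 hx hy => exists_isSol ha1' hb1 ha2 hb2' hx.le hy (by positivity)⟩
    · rw [eq_div_iff hY.ne']
      linarith
    · rw [eq_div_iff hY.ne']
      linarith
    · rintro ⟨u, v⟩ hq hu hv
      obtain ⟨-, -, hvb, hva, hu', hvd⟩ := hq.charpoly ha1' hb1 hb2' hu hv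
      obtain rfl := root_unique hb1 hvb hYb hva hYa hvd hYd
      exact Prod.ext hu' rfl
  · rintro rfl rfl
    exact ⟨fun x y h _ _ n => h.periodic_three ha1'.ne' hb2'.ne' n,
      existsUnique_isEquilib ha1' hb2'⟩
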